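/- arXiv:2109.14484 — 2 statements merged into one kernel-verified Lean document; each statement's English description precedes it below -/
import Mathlib

section
/- Let 0 < c < 1 and p a positive integer. If Q : ℝ → ℝ is smooth, rapidly decaying, and satisfies c·Q'''' + (c−1)·Q − Q^(p+1)/(p+1) = 0 on ℝ, then Q is identically zero. -/
open SchwartzMap

open Filter Topology

theorem eq_zero_of_hasDerivAt_nonneg_of_tendsto_cocompact {f f' : ℝ → ℝ}
    (hf : ∀ x, HasDerivAt f (f' x) x) (hf' : ∀ x, 0 ≤ f' x)
    (hlim : Tendsto f (cocompact ℝ) (𝓝 0)) (x : ℝ) : f' x = 0 := by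
  have hmono : Monotone f := monotone_of_hasDerivAt_nonneg hf hf'
  have hzero : f = fun _ => 0 := funext fun y => le_antisymm
    (hmono.ge_of_tendsto (hlim.mono_left atTop_le_cocompact) y)
    (hmono.le_of_tendsto (hlim.mono_left atBot_le_cocompact) y)
  subst hzero
  exact (hf x).unique (hasDerivAt_const x 0)

theorem eq_zero_of_hasDerivAt_zero_of_tendsto_cocompact {f : ℝ → ℝ}
    (hf : ∀ x, HasDerivAt f 0 x) (hlim : Tendsto f (cocompact ℝ) (𝓝 0)) (x : ℝ) : f x = 0 := by
  have hconst : f = fun _ => f x := funext fun y =>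
    is_const_of_deriv_eq_zero (fun z => (hf z).differentiableAt) (fun z => (hf z).deriv) y x
  rw [hconst] at hlim
  exact tendsto_nhds_unique tendsto_const_nhds hlim

theorem rosenau_no_solitary_wave_of_speed_lt_one
    (Q : 𝓢(ℝ, ℝ)) (c : ℝ) (p : ℕ) (hp : 0 < p)
    (hc0 : 0 < c) (hc1 : c < 1)
    (hODE : ∀ x : ℝ, c * iteratedDeriv 4 Q x + (c - 1) * Q x
      - (Q x) ^ (p + 1) / ((p : ℝ) + 1) = 0) :
    ∀ x : ℝ, Q x = 0 := by
  set Q₁ := derivCLM ℝ ℝ Q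
  set Q₂ := derivCLM ℝ ℝ Q₁
  set Q₃ := derivCLM ℝ ℝ Q₂
  set Q₄ := derivCLM ℝ ℝ Q₃
  have hiter : iteratedDeriv 4 Q = Q₄ := by
    simp only [iteratedDeriv_succ, iteratedDeriv_zero]
    rfl
  rw [hiter] at hODE
  have d₀ : ∀ x, HasDerivAt Q (Q₁ x) x := Q.hasDerivAt
  have d₁ : ∀ x, HasDerivAt Q₁ (Q₂ x) x := Q₁.hasDerivAt
  have d₂ : ∀ x, HasDerivAt Q₂ (Q₃ x) x := Q₂.hasDerivAt
  have d₃ : ∀ x, HasDerivAt Q₃ (Q₄ x) x := Q₃.hasDerivAt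
  have t₀ := Q.tendsto_cocompact
  have t₁ := Q₁.tendsto_cocompact
  have t₂ := Q₂.tendsto_cocompact
  have t₃ := Q₃.tendsto_cocompact
  -- the Hamiltonian of the profile equation vanishes
  have energy := eq_zero_of_hasDerivAt_zero_of_tendsto_cocompact
    (f := fun x => c * (Q₃ x * Q₁ x - Q₂ x ^ 2 / 2) + (c - 1) * (Q x ^ 2 / 2)
      - Q x ^ (p + 2) / (((p : ℝ) + 1) * (p + 2)))
    (fun x => by
      have h := ((((d₃ x).mul (d₁ x)).sub (((d₂ x).pow 2).div_const 2)).const_mul c).add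
        ((((d₀ x).pow 2).div_const 2).const_mul (c - 1)) |>.sub
        (((d₀ x).pow (p + 2)).div_const (((p : ℝ) + 1) * (p + 2)))
      refine h.congr_deriv ?_
      have e : ((p + 2 : ℕ) : ℝ) * Q x ^ (p + 2 - 1) * Q₁ x / (((p : ℝ) + 1) * (p + 2))
          = Q x ^ (p + 1) / ((p : ℝ) + 1) * Q₁ x := by
        rw [show p + 2 - 1 = p + 1 by omega]
        push_cast
        field_simp
      rw [e]
      simp only [Nat.cast_ofNat, Nat.add_one_sub_one, pow_one]
      linear_combination Q₁ x * hODE x)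
    (by
      have h := ((((t₃.mul t₁).sub ((t₂.pow 2).div_const 2)).const_mul c).add
        (((t₀.pow 2).div_const 2).const_mul (c - 1))).sub
        ((t₀.pow (p + 2)).div_const (((p : ℝ) + 1) * (p + 2)))
      simpa using h)
  -- the derivative of the combined energy and Pohozaev flux
  have pohozaev := eq_zero_of_hasDerivAt_nonneg_of_tendsto_cocompact
    (f := fun x => c * (((p : ℝ) + 3) * (Q₂ x * Q₁ x) - Q x * Q₃ x))
    (f' := fun x => p * (1 - c) / 2 * Q x ^ 2 + c * (3 * p + 8) / 2 * Q₂ x ^ 2)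
    (fun x => by
      have h := ((((d₂ x).mul (d₁ x)).const_mul ((p : ℝ) + 3)).sub ((d₀ x).mul (d₃ x))).const_mul c
      refine h.congr_deriv ?_
      have e : ((p : ℝ) + 2) * (Q x ^ (p + 2) / (((p : ℝ) + 1) * (p + 2)))
          = Q x ^ (p + 1) / ((p : ℝ) + 1) * Q x := by
        rw [pow_succ (Q x) (p + 1)]
        field_simp
      linear_combination (p + 2) * energy x + e - Q x * hODE x)
    (fun x => by
      have : 0 ≤ 1 - c := by linarith
      positivity)
    (by
      have h := (((t₂.mul t₁).const_mul ((p : ℝ) + 3)).sub (t₀.mul t₃)).const_mul c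
      simpa using h)
  intro x
  have h : p * (1 - c) / 2 * Q x ^ 2 + c * (3 * p + 8) / 2 * Q₂ x ^ 2 = 0 := pohozaev x
  have hQ₂ : 0 ≤ c * (3 * p + 8) / 2 * Q₂ x ^ 2 := by positivity
  have hpc : 0 < p * (1 - c) / 2 := by
    have : 0 < 1 - c := by linarith
    positivity
  have hQ : Q x ^ 2 ≤ 0 := by
    by_contra! hlt
    linarith [mul_pos hpc hlt]
  exact pow_eq_zero_iff two_ne_zero |>.1 (le_antisymm hQ (sq_nonneg _))
end

section
/- Suppose u : ℝ² → ℝ is a classical solution of u_t + u_x + u_xxxxt + (g(u))_x = 0 on ℝ × (0,∞) with g differentiable, and u(·,t) together with its derivatives up to appropriate order decays rapidly as |x| → ∞. Then the quantity E(t) = ∫_ℝ [u(x,t)² + u_xx(x,t)²] dx is constant in time. -/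
open MeasureTheory Filter

section

open Set

/-- A function with closed sublevel sets that is constant on every interval on which it is bounded
above is constant. By Baire's theorem, the closed set of points near which it is unbounded is
empty. -/
theorem eq_of_eq_on_bounded_intervals {E : ℝ → ℝ} {a b : ℝ} (hab : a ≤ b)
    (hclosed : ∀ c : ℕ, IsClosed {t ∈ Icc a b | E t ≤ c})
    (hE : ∀ s ∈ Icc a b, ∀ t ∈ Icc a b, (∃ C, ∀ r ∈ uIcc s t, E r ≤ C) → E s = E t) :
    E a = E b := by
  set W : Set ℝ := {t | ∃ C, ∀ᶠ r in nhds t, r ∈ Icc a b → E r ≤ C}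
  have hWopen : IsOpen W := by
    rw [isOpen_iff_mem_nhds]
    rintro t ⟨C, hC⟩
    filter_upwards [eventually_eventually_nhds.2 hC] with r hr using ⟨C, hr⟩
  have hsub : ∀ s ∈ Icc a b, ∀ t ∈ Icc a b, uIcc s t ⊆ W → E s = E t := by
    intro s hs t ht hst
    have hI : uIcc s t ⊆ Icc a b := uIcc_subset_Icc hs ht
    refine hE s hs t ht ?_
    have := isCompact_uIcc (a := s) (b := t) |>.induction_on
      (p := fun S => ∃ C, ∀ r ∈ S, r ∈ Icc a b → E r ≤ C) ⟨0, by simp⟩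
      (fun S T hST ⟨C, hC⟩ => ⟨C, fun r hr => hC r (hST hr)⟩)
      (fun S T ⟨C, hC⟩ ⟨D, hD⟩ => ⟨max C D, fun r hr hab => hr.elim
        (fun h => (hC r h hab).trans (le_max_left _ _))
        (fun h => (hD r h hab).trans (le_max_right _ _))⟩)
      (fun r hr => by
        obtain ⟨C, hC⟩ := hst hr
        exact ⟨_, mem_nhdsWithin_of_mem_nhds hC, C, fun r hr => hr⟩)
    obtain ⟨C, hC⟩ := this
    exact ⟨C, fun r hr => hC r hr (hI hr)⟩
  set P : Set ℝ := Icc a b \ W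
  have hPcomp : IsCompact P := isCompact_Icc.diff hWopen
  rcases P.eq_empty_or_nonempty with hempty | hne
  · refine hsub a (left_mem_Icc.2 hab) b (right_mem_Icc.2 hab) ?_
    rw [uIcc_of_le hab]
    exact sdiff_eq_empty.1 hempty
  exfalso
  have : CompactSpace P := isCompact_iff_compactSpace.1 hPcomp
  have : Nonempty P := hne.to_subtype
  obtain ⟨c, p, hp⟩ := nonempty_interior_of_iUnion_of_closed
    (f := fun c : ℕ => {t : P | E t ≤ c})
    (fun c => by
      have := (hclosed c).preimage (continuous_subtype_val (p := (· ∈ P)))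
      convert this using 1
      ext t
      exact ⟨fun h => ⟨t.2.1, h⟩, fun h => h.2⟩)
    (eq_univ_of_forall fun t => mem_iUnion.2 (exists_nat_ge (E t)))
  rw [mem_interior_iff_mem_nhds, Metric.mem_nhds_iff] at hp
  obtain ⟨δ, hδ, hball⟩ := hp
  refine p.2.2 ⟨c, ?_⟩
  filter_upwards [Metric.ball_mem_nhds (p : ℝ) hδ] with t htδ htI
  obtain ⟨q, ⟨hqP, hqt⟩, hqmin⟩ := (hPcomp.inter isCompact_uIcc).exists_infDist_eq_dist
    (s := P ∩ uIcc (p : ℝ) t) ⟨p, p.2, left_mem_uIcc⟩ t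
  have hqδ : dist q p < δ := by
    refine lt_of_le_of_lt ?_ (Metric.mem_ball.1 htδ)
    rw [Real.dist_eq, Real.dist_eq]
    exact abs_sub_left_of_mem_uIcc hqt
  have hqc : E q ≤ c := hball (show (⟨q, hqP⟩ : P) ∈ Metric.ball p δ from hqδ)
  have hconst : ∀ r ∈ uIcc q t, r ≠ q → E r = E t := by
    intro r hr hrq
    have hrI : r ∈ Icc a b := uIcc_subset_Icc hqP.1 htI hr
    refine hsub r hrI t htI fun z hz => ?_
    by_contra hzW
    have hzI : z ∈ Icc a b := uIcc_subset_Icc hrI htI hz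
    have hzq : z ∈ uIcc q t := uIcc_subset_uIcc hr right_mem_uIcc hz
    have hzp : z ∈ uIcc (p : ℝ) t := uIcc_subset_uIcc hqt right_mem_uIcc hzq
    have h1 : dist t q ≤ dist t z := by
      rw [← hqmin]
      exact Metric.infDist_le_dist_of_mem ⟨⟨hzI, hzW⟩, hzp⟩
    rw [Real.dist_eq, Real.dist_eq] at h1
    apply hrq
    rw [mem_uIcc] at hr hz
    rcases hr with ⟨_, _⟩ | ⟨_, _⟩ <;> rcases hz with ⟨_, _⟩ | ⟨_, _⟩ <;>
      rcases abs_cases (t - q) with ⟨_, _⟩ | ⟨_, _⟩ <;>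
      rcases abs_cases (t - z) with ⟨_, _⟩ | ⟨_, _⟩ <;> linarith
  have : E q = E t := by
    refine hE q hqP.1 t htI ⟨max (E q) (E t), fun r hr => ?_⟩
    by_cases hrq : r = q
    · exact hrq ▸ le_max_left _ _
    · exact (hconst r hr hrq).le.trans (le_max_right _ _)
  exact this ▸ hqc

/-- Maximum principle for the equation `y' = c (y - f)`, with `y = p + i q` and `c = a + i b`. -/
theorem sq_add_sq_le_of_hasDerivAt {p q f : ℝ → ℝ} {a b B : ℝ} (ha : a ^ 2 = 1 / 2)
    (hb : b ^ 2 = 1 / 2)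
    (hp : ∀ x, HasDerivAt p (a * p x - b * q x - a * f x) x)
    (hq : ∀ x, HasDerivAt q (b * p x + a * q x - b * f x) x)
    (hp0 : Tendsto p (cocompact ℝ) (nhds 0)) (hq0 : Tendsto q (cocompact ℝ) (nhds 0))
    (hf : ∀ x, |f x| ≤ B) (x : ℝ) : p x ^ 2 + q x ^ 2 ≤ 2 * B ^ 2 := by
  by_cases hx : p x ^ 2 + q x ^ 2 ≤ 0
  · nlinarith [sq_nonneg B]
  push Not at hx
  have hd : ∀ y, HasDerivAt (fun y => p y ^ 2 + q y ^ 2) _ y :=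
    fun y => ((hp y).pow 2).add ((hq y).pow 2)
  have hc : Continuous fun y => p y ^ 2 + q y ^ 2 :=
    continuous_iff_continuousAt.2 fun y => (hd y).continuousAt
  have hlim : Tendsto (fun y => p y ^ 2 + q y ^ 2) (cocompact ℝ) (nhds 0) := by
    simpa using (hp0.pow 2).add (hq0.pow 2)
  obtain ⟨y, hy⟩ := hc.exists_forall_ge' x ((hlim.eventually_lt_const hx).mono fun _ h => h.le)
  have h0 := IsLocalMax.hasDerivAt_eq_zero (Eventually.of_forall hy) (hd y)
  refine (hy x).trans ?_
  have hfy : f y ^ 2 ≤ B ^ 2 := sq_le_sq' (by linarith [neg_abs_le (f y), hf y])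
    ((le_abs_self _).trans (hf y))
  have hpos : 0 < p y ^ 2 + q y ^ 2 := hx.trans_le (hy x)
  have h1 : a * (p y ^ 2 + q y ^ 2) = f y * (a * p y + b * q y) := by
    simp at h0; linarith
  have h2 : (p y ^ 2 + q y ^ 2) * (p y ^ 2 + q y ^ 2) ≤ (p y ^ 2 + q y ^ 2) * (2 * f y ^ 2) := by
    have e1 : (a * (p y ^ 2 + q y ^ 2)) ^ 2 = (p y ^ 2 + q y ^ 2) ^ 2 / 2 := by
      rw [mul_pow, ha]; ring
    have e2 : (a * p y + b * q y) ^ 2 ≤ p y ^ 2 + q y ^ 2 := by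
      have : (a * p y + b * q y) ^ 2 + (b * p y - a * q y) ^ 2 =
          (a ^ 2 + b ^ 2) * (p y ^ 2 + q y ^ 2) := by ring
      rw [ha, hb] at this
      nlinarith [sq_nonneg (b * p y - a * q y)]
    rw [h1, mul_pow] at e1
    nlinarith [mul_le_mul_of_nonneg_left e2 (sq_nonneg (f y))]
  linarith [le_of_mul_le_mul_left h2 hpos]

/-- Uniform bounds for the decaying solution of `v + v'''' + f' = 0`, obtained by factoring
`1 + D ^ 4` into first-order operators. -/
theorem abs_le_of_add_fourth_deriv_eq {v₀ v₁ v₂ v₃ v₄ f f' : ℝ → ℝ} {B : ℝ}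
    (h₀ : ∀ x, HasDerivAt v₀ (v₁ x) x) (h₁ : ∀ x, HasDerivAt v₁ (v₂ x) x)
    (h₂ : ∀ x, HasDerivAt v₂ (v₃ x) x) (h₃ : ∀ x, HasDerivAt v₃ (v₄ x) x)
    (hf : ∀ x, HasDerivAt f (f' x) x) (heq : ∀ x, v₀ x + v₄ x + f' x = 0)
    (l₀ : Tendsto v₀ (cocompact ℝ) (nhds 0)) (l₁ : Tendsto v₁ (cocompact ℝ) (nhds 0))
    (l₂ : Tendsto v₂ (cocompact ℝ) (nhds 0)) (l₃ : Tendsto v₃ (cocompact ℝ) (nhds 0))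
    (lf : Tendsto f (cocompact ℝ) (nhds 0)) (hB : ∀ x, |f x| ≤ B) (x : ℝ) :
    |v₂ x| ≤ 3 * B ∧ |v₃ x| ≤ 3 * B := by
  obtain ⟨s, hs⟩ : ∃ s : ℝ, s ^ 2 = 1 / 2 := ⟨√(1 / 2), Real.sq_sqrt (by norm_num)⟩
  have key : ∀ σ : ℝ, σ ^ 2 = 1 →
      (v₃ x + f x + σ * s * (v₂ x - v₀ x)) ^ 2 + (s * (v₀ x + v₂ x) + σ * v₁ x) ^ 2
        ≤ 2 * B ^ 2 := by
    intro σ hσ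
    refine sq_add_sq_le_of_hasDerivAt (a := σ * s) (b := s) (f := f)
      (p := fun x => v₃ x + f x + σ * s * (v₂ x - v₀ x))
      (q := fun x => s * (v₀ x + v₂ x) + σ * v₁ x) (by rw [mul_pow, hσ, hs, one_mul]) hs
      (fun y => ?_) (fun y => ?_) ?_ ?_ hB x
    · refine (((h₃ y).add (hf y)).add (((h₂ y).sub (h₀ y)).const_mul (σ * s))).congr_deriv ?_
      linear_combination heq y + (v₀ y - v₂ y) * s ^ 2 * hσ + 2 * v₀ y * hs
    · refine ((((h₀ y).add (h₂ y)).const_mul s).add ((h₁ y).const_mul σ)).congr_deriv ?_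
      linear_combination -(2 * σ * v₂ y) * hs - s * v₁ y * hσ
    · simpa using (l₃.add lf).add ((l₂.sub l₀).const_mul (σ * s))
    · simpa using ((l₀.add l₂).const_mul s).add (l₁.const_mul σ)
  have kp := key 1 (by norm_num)
  have km := key (-1) (by norm_num)
  have hB0 : 0 ≤ B := (abs_nonneg _).trans (hB x)
  have hw : (v₃ x + f x) ^ 2 ≤ (2 * B) ^ 2 := by
    nlinarith [sq_nonneg (s * (v₂ x - v₀ x)), sq_nonneg (s * (v₀ x + v₂ x)), sq_nonneg (v₁ x)]
  have hv : v₂ x ^ 2 ≤ (3 * B) ^ 2 := by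
    have e : (s * (v₂ x - v₀ x)) ^ 2 + (s * (v₀ x + v₂ x)) ^ 2 = v₂ x ^ 2 + v₀ x ^ 2 := by
      linear_combination 2 * (v₂ x ^ 2 + v₀ x ^ 2) * hs
    nlinarith [sq_nonneg (v₃ x + f x), sq_nonneg (v₀ x), sq_nonneg (v₁ x)]
  refine ⟨abs_le_of_sq_le_sq hv (by positivity), ?_⟩
  have := abs_le_of_sq_le_sq hw (by positivity)
  have h3 := abs_sub (v₃ x + f x) (f x)
  rw [add_sub_cancel_right] at h3
  linarith [hB x]

theorem abs_sub_le_of_abs_deriv_le {A A' e : ℝ → ℝ} {C x : ℝ}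
    (hA : ∀ y, HasDerivAt A (A' y) y) (hA' : Continuous A') (he : Integrable e) (he0 : 0 ≤ e)
    (hle : ∀ y ∈ Icc x (x + 1), |A' y| ≤ C + e y) :
    |A (x + 1) - A x| ≤ C + ∫ y, e y := by
  have hx : x ≤ x + 1 := by linarith
  rw [← Real.norm_eq_abs, ← intervalIntegral.integral_eq_sub_of_hasDerivAt (fun y _ => hA y)
    (hA'.intervalIntegrable _ _)]
  have hint : IntervalIntegrable (fun y => C + e y) volume x (x + 1) :=
    intervalIntegrable_const.add he.intervalIntegrable
  calc ‖∫ y in x..x + 1, A' y‖ ≤ ∫ y in x..x + 1, (C + e y) :=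
        intervalIntegral.norm_integral_le_of_norm_le hx
          (Eventually.of_forall fun y hy => hle y (Ioc_subset_Icc_self hy))
          hint
    _ = C + ∫ y in x..x + 1, e y := by
        rw [intervalIntegral.integral_add intervalIntegrable_const he.intervalIntegrable]
        simp
    _ ≤ C + ∫ y, e y := by
        rw [intervalIntegral.integral_of_le hx]
        exact add_le_add_right (setIntegral_le_integral he (Eventually.of_forall he0)) C

/-- The Sobolev bound of `h` and `h'` by the integral of `h ^ 2 + h'' ^ 2`. -/
theorem abs_le_of_integrable_sq_add_sq {h₀ h₁ h₂ : ℝ → ℝ} (d₀ : ∀ x, HasDerivAt h₀ (h₁ x) x)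
    (d₁ : ∀ x, HasDerivAt h₁ (h₂ x) x) (hc : Continuous h₂)
    (hint : Integrable fun x => h₀ x ^ 2 + h₂ x ^ 2) (x : ℝ) :
    |h₀ x| ≤ 10 + (∫ y, (h₀ y ^ 2 + h₂ y ^ 2)) ∧
      |h₁ x| ≤ 10 + ∫ y, (h₀ y ^ 2 + h₂ y ^ 2) := by
  have c₀ : Continuous h₀ := continuous_iff_continuousAt.2 fun y => (d₀ y).continuousAt
  have hnn : 0 ≤ fun x => h₀ x ^ 2 + h₂ x ^ 2 := fun y => by positivity
  have key : ∀ η η' η'' : ℝ → ℝ, (∀ z, HasDerivAt η (η' z) z) → (∀ z, HasDerivAt η' (η'' z) z) →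
      Continuous η'' → η 1 = 0 → η' 1 = 0 →
      (∀ z ∈ Icc (0 : ℝ) 1, |η z| ≤ 1 ∧ |η'' z| ≤ 6) →
      |η' 0 * h₀ x - η 0 * h₁ x| ≤ 10 + ∫ y, (h₀ y ^ 2 + h₂ y ^ 2) := by
    intro η η' η'' hη hη' hη'' e e' hb
    have cη : Continuous η := continuous_iff_continuousAt.2 fun y => (hη y).continuousAt
    have := abs_sub_le_of_abs_deriv_le (x := x) (C := 10)
      (A := fun y => η (y - x) * h₁ y - η' (y - x) * h₀ y)
      (A' := fun y => η (y - x) * h₂ y - η'' (y - x) * h₀ y)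
      (fun y => by
        refine ((((hη (y - x)).comp_sub_const y x).mul (d₁ y)).sub
          (((hη' (y - x)).comp_sub_const y x).mul (d₀ y))).congr_deriv ?_
        ring)
      (by fun_prop) hint hnn
      (fun y hy => by
        obtain ⟨b0, b2⟩ := hb (y - x) ⟨by linarith [hy.1], by linarith [hy.2]⟩
        have := abs_sub (η (y - x) * h₂ y) (η'' (y - x) * h₀ y)
        rw [abs_mul, abs_mul] at this
        have h1 := mul_le_mul_of_nonneg_right b0 (abs_nonneg (h₂ y))
        have h2 := mul_le_mul_of_nonneg_right b2 (abs_nonneg (h₀ y))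
        nlinarith [sq_abs (h₂ y), sq_abs (h₀ y), sq_nonneg (|h₂ y| - 1), sq_nonneg (|h₀ y| - 3)])
    simpa [e, e', abs_sub_comm] using this
  constructor
  · have := key (fun z => z * (1 - z) ^ 2) (fun z => 1 - 4 * z + 3 * z ^ 2) (fun z => 6 * z - 4)
      (fun z => by
        refine HasDerivAt.congr_deriv ((hasDerivAt_id z).mul (((hasDerivAt_id z).const_sub 1).pow 2)) ?_
        simp; ring)
      (fun z => by
        refine HasDerivAt.congr_deriv ((((hasDerivAt_id z).const_mul 4).const_sub 1).add
          (((hasDerivAt_id z).pow 2).const_mul 3)) ?_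
        simp; ring)
      (by fun_prop) (by norm_num) (by norm_num)
      (fun z ⟨hz0, hz1⟩ => ⟨abs_le.2 ⟨by nlinarith [mul_nonneg hz0 (sq_nonneg (1 - z))], by nlinarith⟩,
        abs_le.2 ⟨by linarith, by linarith⟩⟩)
    simpa using this
  · have := key (fun z => 1 - 3 * z ^ 2 + 2 * z ^ 3) (fun z => -6 * z + 6 * z ^ 2)
      (fun z => -6 + 12 * z)
      (fun z => by
        refine HasDerivAt.congr_deriv (((((hasDerivAt_id z).pow 2).const_mul 3).const_sub 1).add
          (((hasDerivAt_id z).pow 3).const_mul 2)) ?_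
        simp; ring)
      (fun z => by
        refine HasDerivAt.congr_deriv (((hasDerivAt_id z).const_mul (-6)).add
          (((hasDerivAt_id z).pow 2).const_mul 6)) ?_
        simp; ring)
      (by fun_prop) (by norm_num) (by norm_num)
      (fun z ⟨hz0, hz1⟩ => ⟨abs_le.2
          ⟨by nlinarith [mul_nonneg (sq_nonneg (1 - z)) hz0, sq_nonneg (1 - z)],
            by nlinarith [sq_nonneg z]⟩,
        abs_le.2 ⟨by linarith, by linarith⟩⟩)
    simpa using this

theorem hasDerivAt_fst_uncurry {w : ℝ → ℝ → ℝ} {x t : ℝ}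
    (hw : DifferentiableAt ℝ (Function.uncurry w) (x, t)) :
    HasDerivAt (fun y => w y t) (fderiv ℝ (Function.uncurry w) (x, t) (1, 0)) x :=
  hw.hasFDerivAt.comp_hasDerivAt (f := fun y => (y, t)) x
    ((hasDerivAt_id x).prodMk (hasDerivAt_const x t))

theorem hasDerivAt_snd_uncurry {w : ℝ → ℝ → ℝ} {x t : ℝ}
    (hw : DifferentiableAt ℝ (Function.uncurry w) (x, t)) :
    HasDerivAt (fun s => w x s) (fderiv ℝ (Function.uncurry w) (x, t) (0, 1)) t :=
  hw.hasFDerivAt.comp_hasDerivAt (f := fun s => (x, s)) t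
    ((hasDerivAt_const t x).prodMk (hasDerivAt_id t))

theorem uncurry_deriv_fst_eq {w : ℝ → ℝ → ℝ} (hw : ContDiff ℝ (⊤ : ℕ∞) (Function.uncurry w)) :
    Function.uncurry (fun x t => deriv (fun y => w y t) x) =
      fun z => fderiv ℝ (Function.uncurry w) z (1, 0) := by
  ext ⟨x, t⟩
  exact (hasDerivAt_fst_uncurry (hw.differentiable (by simp) _)).deriv

theorem uncurry_deriv_snd_eq {w : ℝ → ℝ → ℝ} (hw : ContDiff ℝ (⊤ : ℕ∞) (Function.uncurry w)) :
    Function.uncurry (fun x t => deriv (fun s => w x s) t) =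
      fun z => fderiv ℝ (Function.uncurry w) z (0, 1) := by
  ext ⟨x, t⟩
  exact (hasDerivAt_snd_uncurry (hw.differentiable (by simp) _)).deriv

theorem contDiff_deriv_fst {w : ℝ → ℝ → ℝ} (hw : ContDiff ℝ (⊤ : ℕ∞) (Function.uncurry w)) :
    ContDiff ℝ (⊤ : ℕ∞) (Function.uncurry fun x t => deriv (fun y => w y t) x) := by
  rw [uncurry_deriv_fst_eq hw]
  exact (hw.fderiv_right (by simp)).clm_apply contDiff_const

theorem contDiff_deriv_snd {w : ℝ → ℝ → ℝ} (hw : ContDiff ℝ (⊤ : ℕ∞) (Function.uncurry w)) :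
    ContDiff ℝ (⊤ : ℕ∞) (Function.uncurry fun x t => deriv (fun s => w x s) t) := by
  rw [uncurry_deriv_snd_eq hw]
  exact (hw.fderiv_right (by simp)).clm_apply contDiff_const

theorem deriv_deriv_comm {w : ℝ → ℝ → ℝ} (hw : ContDiff ℝ (⊤ : ℕ∞) (Function.uncurry w))
    (x t : ℝ) : deriv (fun y => deriv (fun s => w y s) t) x =
      deriv (fun s => deriv (fun y => w y s) x) t := by
  have hd : DifferentiableAt ℝ (fderiv ℝ (Function.uncurry w)) (x, t) :=
    (hw.fderiv_right (m := (⊤ : ℕ∞)) (by simp)).differentiable (by simp) _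
  have h1 := (hasDerivAt_fst_uncurry ((contDiff_deriv_snd hw).differentiable (by simp) (x, t))).deriv
  have h2 := (hasDerivAt_snd_uncurry ((contDiff_deriv_fst hw).differentiable (by simp) (x, t))).deriv
  rw [h1, h2, uncurry_deriv_fst_eq hw, uncurry_deriv_snd_eq hw,
    fderiv_clm_apply hd (differentiableAt_const _), fderiv_clm_apply hd (differentiableAt_const _)]
  have h2le : minSmoothness ℝ 2 ≤ ((⊤ : ℕ∞) : WithTop ℕ∞) := by
    rw [minSmoothness_of_isRCLikeNormedField]
    exact WithTop.coe_le_coe.2 (le_top : (2 : ℕ∞) ≤ ⊤)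
  simpa using (hw.contDiffAt.isSymmSndFDerivAt h2le).eq (1, 0) (0, 1)

theorem contDiff_iteratedDeriv_fst {w : ℝ → ℝ → ℝ}
    (hw : ContDiff ℝ (⊤ : ℕ∞) (Function.uncurry w)) (i : ℕ) :
    ContDiff ℝ (⊤ : ℕ∞) (Function.uncurry fun x t => iteratedDeriv i (fun y => w y t) x) := by
  induction i with
  | zero => simpa using hw
  | succ i ih => simpa only [iteratedDeriv_succ] using contDiff_deriv_fst ih

/-- The energy takes the same value at the ends of a time interval on which it is bounded: the
boundary flux of the local energy is then dominated and vanishes at spatial infinity. -/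
theorem energy_eq_of_bounded {U V : ℕ → ℝ → ℝ → ℝ} {g : ℝ → ℝ} {s t : ℝ}
    (hg : Differentiable ℝ g)
    (cU : ∀ i, Continuous (Function.uncurry (U i))) (cV : ∀ i, Continuous (Function.uncurry (V i)))
    (dU : ∀ i x r, HasDerivAt (fun y => U i y r) (U (i + 1) x r) x)
    (dV : ∀ i x r, HasDerivAt (fun y => V i y r) (V (i + 1) x r) x)
    (dUt : ∀ i x r, HasDerivAt (fun r => U i x r) (V i x r) r)
    (hpde : ∀ r ∈ uIcc s t, ∀ x,
      V 0 x r + U 1 x r + V 4 x r + deriv g (U 0 x r) * U 1 x r = 0)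
    (lU : ∀ r ∈ uIcc s t, ∀ i, Tendsto (fun x => U i x r) (cocompact ℝ) (nhds 0))
    (lV : ∀ r ∈ uIcc s t, ∀ i, Tendsto (fun x => V i x r) (cocompact ℝ) (nhds 0))
    (hint : ∀ r ∈ uIcc s t, Integrable fun x => U 0 x r ^ 2 + U 2 x r ^ 2)
    (hbdd : ∃ C, ∀ r ∈ uIcc s t, ∫ x, (U 0 x r ^ 2 + U 2 x r ^ 2) ≤ C) :
    ∫ x, (U 0 x s ^ 2 + U 2 x s ^ 2) = ∫ x, (U 0 x t ^ 2 + U 2 x t ^ 2) := by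
  obtain ⟨C, hC⟩ := hbdd
  set F : ℝ → ℝ := fun z => z + g z - g 0 with hF
  set H : ℝ → ℝ := fun z => ∫ y in (0 : ℝ)..z, F y with hH
  have cF : Continuous F := by have := hg.continuous; fun_prop
  have F0 : F 0 = 0 := by simp [hF]
  have H0 : H 0 = 0 := by simp [hH]
  have dF : ∀ z, HasDerivAt F (1 + deriv g z) z := fun z =>
    ((hasDerivAt_id z).add (hg z).hasDerivAt).sub_const _
  have dH : ∀ z, HasDerivAt H (F z) z := fun z => cF.integral_hasStrictDerivAt 0 z |>.hasDerivAt
  have cH : Continuous H := continuous_iff_continuousAt.2 fun z => (dH z).continuousAt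
  set Φ : ℝ → ℝ → ℝ := fun x r => -2 * (U 0 x r * V 3 x r - U 1 x r * V 2 x r
    + U 0 x r * F (U 0 x r) - H (U 0 x r)) with hΦ
  have cU' : ∀ i, Continuous fun z : ℝ × ℝ => U i z.1 z.2 := cU
  have cV' : ∀ i, Continuous fun z : ℝ × ℝ => V i z.1 z.2 := cV
  have cΦ : Continuous (Function.uncurry Φ) := by
    have := (((cU' 0).mul (cV' 3)).sub ((cU' 1).mul (cV' 2))).add
      ((cU' 0).mul (cF.comp (cU' 0))) |>.sub (cH.comp (cU' 0))
    exact this.const_mul (-2)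
  have dFU : ∀ x r, HasDerivAt (fun y => F (U 0 y r)) ((1 + deriv g (U 0 x r)) * U 1 x r) x :=
    fun x r => (dF _).comp x (dU 0 x r)
  have dΦ : ∀ r ∈ uIcc s t, ∀ x, HasDerivAt (fun y => Φ y r)
      (2 * U 0 x r * V 0 x r + 2 * U 2 x r * V 2 x r) x := by
    intro r hr x
    refine ((((((dU 0 x r).mul (dV 3 x r)).sub ((dU 1 x r).mul (dV 2 x r))).add
      ((dU 0 x r).mul (dFU x r))).sub ((dH _).comp x (dU 0 x r))).const_mul (-2)).congr_deriv ?_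
    norm_num
    linear_combination (-2 * U 0 x r) * hpde r hr x
  have lFU : ∀ r ∈ uIcc s t, Tendsto (fun x => F (U 0 x r)) (cocompact ℝ) (nhds 0) :=
    fun r hr => (cF.tendsto' 0 0 F0).comp (lU r hr 0)
  have lΦ : ∀ r ∈ uIcc s t, Tendsto (fun x => Φ x r) (cocompact ℝ) (nhds 0) := by
    intro r hr
    have hHU : Tendsto (fun x => H (U 0 x r)) (cocompact ℝ) (nhds 0) :=
      (cH.tendsto' 0 0 H0).comp (lU r hr 0)
    simpa [-cocompact_eq_atBot_atTop, hΦ] using (((((lU r hr 0).mul (lV r hr 3)).sub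
      ((lU r hr 1).mul (lV r hr 2))).add
      ((lU r hr 0).mul (lFU r hr))).sub hHU).const_mul (-2)
  obtain ⟨K, hK⟩ : ∃ K, ∀ r ∈ uIcc s t, ∀ x, |Φ x r| ≤ K := by
    set M := 10 + C
    obtain ⟨B, hB⟩ := isCompact_Icc.exists_bound_of_continuousOn (s := Icc (-M) M) cF.continuousOn
    obtain ⟨D, hD⟩ := isCompact_Icc.exists_bound_of_continuousOn (s := Icc (-M) M) cH.continuousOn
    refine ⟨2 * (M * (3 * B) + M * (3 * B) + M * B + D), fun r hr x => ?_⟩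
    have hsob : ∀ y, |U 0 y r| ≤ M ∧ |U 1 y r| ≤ M := fun y => by
      have cU2 : Continuous fun y => U 2 y r := (cU' 2).comp (by fun_prop : Continuous fun y => (y, r))
      obtain ⟨h0, h1⟩ := abs_le_of_integrable_sq_add_sq (dU 0 · r) (dU 1 · r) cU2 (hint r hr) y
      exact ⟨by linarith [hC r hr], by linarith [hC r hr]⟩
    have hFB : ∀ y, |F (U 0 y r)| ≤ B := fun y => hB _ (abs_le.1 (hsob y).1)
    obtain ⟨h2, h3⟩ := abs_le_of_add_fourth_deriv_eq (dV 0 · r) (dV 1 · r) (dV 2 · r) (dV 3 · r)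
      (dFU · r) (fun y => by linear_combination hpde r hr y) (lV r hr 0) (lV r hr 1) (lV r hr 2)
      (lV r hr 3) (lFU r hr) hFB x
    have hM : 0 ≤ M := (abs_nonneg _).trans (hsob x).1
    have e1 : |U 0 x r * V 3 x r| ≤ M * (3 * B) := by
      rw [abs_mul]; exact mul_le_mul (hsob x).1 h3 (abs_nonneg _) hM
    have e2 : |U 1 x r * V 2 x r| ≤ M * (3 * B) := by
      rw [abs_mul]; exact mul_le_mul (hsob x).2 h2 (abs_nonneg _) hM
    have e3 : |U 0 x r * F (U 0 x r)| ≤ M * B := by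
      rw [abs_mul]; exact mul_le_mul (hsob x).1 (hFB x) (abs_nonneg _) hM
    have e4 : |H (U 0 x r)| ≤ D := hD _ (abs_le.1 (hsob x).1)
    rw [abs_le] at e1 e2 e3 e4
    rw [hΦ, abs_le]
    constructor <;> linarith
  have hflux : ∀ R : ℝ, (∫ x in -R..R, (U 0 x t ^ 2 + U 2 x t ^ 2))
      - (∫ x in -R..R, (U 0 x s ^ 2 + U 2 x s ^ 2)) = ∫ r in s..t, (Φ R r - Φ (-R) r) := by
    intro R
    have ce : ∀ r, Continuous fun x => U 0 x r ^ 2 + U 2 x r ^ 2 := fun r =>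
      (((cU' 0).pow 2).add ((cU' 2).pow 2)).comp (by fun_prop : Continuous fun x => (x, r))
    have cet : Continuous fun z : ℝ × ℝ =>
        2 * U 0 z.1 z.2 * V 0 z.1 z.2 + 2 * U 2 z.1 z.2 * V 2 z.1 z.2 :=
      (((cU' 0).const_mul 2).mul (cV' 0)).add (((cU' 2).const_mul 2).mul (cV' 2))
    rw [← intervalIntegral.integral_sub ((ce t).intervalIntegrable _ _)
      ((ce s).intervalIntegrable _ _)]
    calc _ = ∫ x in -R..R, ∫ r in s..t,
          (2 * U 0 x r * V 0 x r + 2 * U 2 x r * V 2 x r) := by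
          refine intervalIntegral.integral_congr fun x _ => ?_
          refine (intervalIntegral.integral_eq_sub_of_hasDerivAt
            (f := fun r => U 0 x r ^ 2 + U 2 x r ^ 2) (fun r _ => ?_) ?_).symm
          · refine (((dUt 0 x r).pow 2).add ((dUt 2 x r).pow 2)).congr_deriv ?_
            norm_num
          · exact (cet.comp (by fun_prop : Continuous fun r => (x, r))).intervalIntegrable _ _
      _ = ∫ r in s..t, ∫ x in -R..R,
          (2 * U 0 x r * V 0 x r + 2 * U 2 x r * V 2 x r) :=
          intervalIntegral_intervalIntegral_swap <|
            (cet.continuousOn.integrableOn_compact (isCompact_uIcc.prod isCompact_uIcc)).mono_set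
              (prod_mono uIoc_subset_uIcc uIoc_subset_uIcc)
      _ = _ := by
          refine intervalIntegral.integral_congr fun r hr => ?_
          exact intervalIntegral.integral_eq_sub_of_hasDerivAt (f := fun x => Φ x r)
            (fun x _ => dΦ r hr x)
            ((cet.comp (by fun_prop : Continuous fun x => (x, r))).intervalIntegrable _ _)
  have hright : Tendsto (fun R : ℝ => ∫ r in s..t, (Φ R r - Φ (-R) r)) atTop (nhds 0) := by
    have := intervalIntegral.tendsto_integral_filter_of_dominated_convergence (a := s) (b := t)
      (μ := volume) (l := atTop) (F := fun R r => Φ R r - Φ (-R) r) (f := fun _ => 0)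
      (fun _ => K + K)
      (Eventually.of_forall fun R => Continuous.aestronglyMeasurable <|
        (cΦ.comp (by fun_prop : Continuous fun r => (R, r))).sub
          (cΦ.comp (by fun_prop : Continuous fun r => (-R, r))))
      (Eventually.of_forall fun R => Eventually.of_forall fun r hr =>
        (norm_sub_le _ _).trans (add_le_add (hK r (uIoc_subset_uIcc hr) _)
          (hK r (uIoc_subset_uIcc hr) _)))
      intervalIntegrable_const
      (Eventually.of_forall fun r hr => by
        have h := lΦ r (uIoc_subset_uIcc hr)
        rw [cocompact_eq_atBot_atTop] at h
        simpa using (h.mono_left le_sup_right).sub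
          ((h.mono_left le_sup_left).comp tendsto_neg_atTop_atBot))
    simpa using this
  have hleft := (intervalIntegral_tendsto_integral (hint t right_mem_uIcc)
    tendsto_neg_atTop_atBot tendsto_id).sub (intervalIntegral_tendsto_integral
      (hint s left_mem_uIcc) tendsto_neg_atTop_atBot tendsto_id)
  have := tendsto_nhds_unique (hleft.congr hflux) hright
  linarith

/-- Sublevel sets of the integral of a nonnegative continuous density are closed in time. -/
theorem isClosed_energy_le {e : ℝ → ℝ → ℝ} {a b : ℝ} (he : Continuous (Function.uncurry e))
    (hnn : ∀ x t, 0 ≤ e x t) (hint : ∀ t ∈ Icc a b, Integrable fun x => e x t) (c : ℝ) :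
    IsClosed {t ∈ Icc a b | ∫ x, e x t ≤ c} := by
  have heq : {t ∈ Icc a b | ∫ x, e x t ≤ c} =
      Icc a b ∩ ⋂ n : ℕ, {t | ∫ x in -(n : ℝ)..n, e x t ≤ c} := by
    ext t
    simp only [mem_ofPred_eq, mem_inter_iff, mem_iInter]
    refine and_congr_right fun ht => ⟨fun h n => ?_, fun h => ?_⟩
    · rw [intervalIntegral.integral_of_le (by linarith [n.cast_nonneg (α := ℝ)])]
      exact (setIntegral_le_integral (hint t ht) (Eventually.of_forall fun x => hnn x t)).trans h
    · exact le_of_tendsto' (intervalIntegral_tendsto_integral (hint t ht)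
        (tendsto_neg_atTop_atBot.comp tendsto_natCast_atTop_atTop)
        tendsto_natCast_atTop_atTop) h
  rw [heq]
  refine isClosed_Icc.inter (isClosed_iInter fun n => isClosed_le ?_ continuous_const)
  exact intervalIntegral.continuous_parametric_intervalIntegral_of_continuous'
    (f := fun t x => e x t) (he.comp continuous_swap) _ _

end

/-- Conservation of the Rosenau energy `E(t) = ∫ (u² + u_xx²) dx` for classical,
rapidly decaying solutions of `u_t + u_x + u_xxxxt + (g(u))_x = 0`. -/
theorem rosenau_energy_conservation
    (u : ℝ → ℝ → ℝ) (g : ℝ → ℝ)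
    (hu : ContDiff ℝ (⊤ : ℕ∞) (Function.uncurry u))
    (hg : Differentiable ℝ g)
    (hPDE : ∀ x : ℝ, ∀ t : ℝ, 0 < t →
      deriv (fun s => u x s) t
        + deriv (fun y => u y t) x
        + deriv (fun s => iteratedDeriv 4 (fun y => u y s) x) t
        + deriv (fun y => g (u y t)) x = 0)
    (hdecayTop : ∀ t : ℝ, 0 < t → ∀ i : ℕ,
      Tendsto (fun x => iteratedDeriv i (fun y => u y t) x) atTop (nhds 0))
    (hdecayBot : ∀ t : ℝ, 0 < t → ∀ i : ℕ,
      Tendsto (fun x => iteratedDeriv i (fun y => u y t) x) atBot (nhds 0))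
    (hdecayTop' : ∀ t : ℝ, 0 < t → ∀ i : ℕ,
      Tendsto (fun x => deriv (fun s => iteratedDeriv i (fun y => u y s) x) t)
        atTop (nhds 0))
    (hdecayBot' : ∀ t : ℝ, 0 < t → ∀ i : ℕ,
      Tendsto (fun x => deriv (fun s => iteratedDeriv i (fun y => u y s) x) t)
        atBot (nhds 0))
    (hint : ∀ t : ℝ, 0 < t →
      Integrable (fun x => (u x t) ^ 2 + (iteratedDeriv 2 (fun y => u y t) x) ^ 2)) :
    ∀ t₁ t₂ : ℝ, 0 < t₁ → 0 < t₂ →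
      (∫ x : ℝ, ((u x t₁) ^ 2 + (iteratedDeriv 2 (fun y => u y t₁) x) ^ 2))
        = ∫ x : ℝ, ((u x t₂) ^ 2 + (iteratedDeriv 2 (fun y => u y t₂) x) ^ 2) := by
  set U : ℕ → ℝ → ℝ → ℝ := fun i x t => iteratedDeriv i (fun y => u y t) x with hU
  set V : ℕ → ℝ → ℝ → ℝ := fun i x t => deriv (fun s => U i x s) t with hV
  have sU : ∀ i, ContDiff ℝ (⊤ : ℕ∞) (Function.uncurry (U i)) := contDiff_iteratedDeriv_fst hu
  have sV : ∀ i, ContDiff ℝ (⊤ : ℕ∞) (Function.uncurry (V i)) := fun i =>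
    contDiff_deriv_snd (sU i)
  have U0 : ∀ x t, U 0 x t = u x t := fun x t => by simp [hU]
  have U1 : ∀ x t, U 1 x t = deriv (fun y => u y t) x := fun x t => by simp [hU]
  have Usucc : ∀ i x t, U (i + 1) x t = deriv (fun y => U i y t) x := fun i x t => by
    simp [hU, iteratedDeriv_succ]
  have dU : ∀ i x t, HasDerivAt (fun y => U i y t) (U (i + 1) x t) x := fun i x t => by
    rw [Usucc]
    exact (hasDerivAt_fst_uncurry ((sU i).differentiable (by simp) _)).differentiableAt.hasDerivAt
  have dUt : ∀ i x t, HasDerivAt (fun s => U i x s) (V i x t) t := fun i x t =>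
    (hasDerivAt_snd_uncurry ((sU i).differentiable (by simp) _)).differentiableAt.hasDerivAt
  have dV : ∀ i x t, HasDerivAt (fun y => V i y t) (V (i + 1) x t) x := fun i x t => by
    have : V (i + 1) x t = deriv (fun y => V i y t) x := by
      simp only [hV, Usucc]
      exact (deriv_deriv_comm (sU i) x t).symm
    rw [this]
    exact (hasDerivAt_fst_uncurry ((sV i).differentiable (by simp) _)).differentiableAt.hasDerivAt
  have pde : ∀ t, 0 < t → ∀ x,
      V 0 x t + U 1 x t + V 4 x t + deriv g (U 0 x t) * U 1 x t = 0 := fun t ht x => by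
    have hcomp : deriv (fun y => g (u y t)) x = deriv g (U 0 x t) * U 1 x t := by
      have := ((hg (U 0 x t)).hasDerivAt.comp x (dU 0 x t)).deriv
      simpa only [Function.comp_def, U0] using this
    have h := hPDE x t ht
    rw [hcomp, ← U1] at h
    simpa only [hV, U0] using h
  have lU : ∀ t, 0 < t → ∀ i, Tendsto (fun x => U i x t) (cocompact ℝ) (nhds 0) :=
    fun t ht i => by
      rw [cocompact_eq_atBot_atTop]
      exact (hdecayBot t ht i).sup (hdecayTop t ht i)
  have lV : ∀ t, 0 < t → ∀ i, Tendsto (fun x => V i x t) (cocompact ℝ) (nhds 0) :=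
    fun t ht i => by
      rw [cocompact_eq_atBot_atTop]
      exact (hdecayBot' t ht i).sup (hdecayTop' t ht i)
  have hint' : ∀ t, 0 < t → Integrable fun x => U 0 x t ^ 2 + U 2 x t ^ 2 := fun t ht => by
    simpa only [U0] using hint t ht
  have main : ∀ a b, 0 < a → a ≤ b →
      ∫ x, (U 0 x a ^ 2 + U 2 x a ^ 2) = ∫ x, (U 0 x b ^ 2 + U 2 x b ^ 2) := by
    intro a b ha hab
    have cE : Continuous (Function.uncurry fun x t => U 0 x t ^ 2 + U 2 x t ^ 2) :=
      ((sU 0).continuous.pow 2).add ((sU 2).continuous.pow 2)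
    refine eq_of_eq_on_bounded_intervals (E := fun t => ∫ x, (U 0 x t ^ 2 + U 2 x t ^ 2)) hab
      (fun c => isClosed_energy_le (e := fun x t => U 0 x t ^ 2 + U 2 x t ^ 2)
        cE (fun x t => by positivity)
        (fun t ht => hint' t (ha.trans_le ht.1)) c) fun s hs t ht hbdd => ?_
    have hpos : ∀ r ∈ Set.uIcc s t, 0 < r := fun r hr =>
      ha.trans_le (Set.uIcc_subset_Icc hs ht hr).1
    exact energy_eq_of_bounded hg (fun i => (sU i).continuous) (fun i => (sV i).continuous) dU dV
      dUt (fun r hr => pde r (hpos r hr)) (fun r hr => lU r (hpos r hr))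
      (fun r hr => lV r (hpos r hr)) (fun r hr => hint' r (hpos r hr)) hbdd
  intro t₁ t₂ h₁ h₂
  simp only [U0] at main
  rcases le_total t₁ t₂ with h | h
  · exact main t₁ t₂ h₁ h
  · exact (main t₂ t₁ h₂ h).symm
end
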